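/- For every positive integer m, multi-indices n, z ∈ ℕ^m, and natural numbers p, q with p ≥ n·z and q ≥ 1, one has ∑_{k=0}^{n} ( C(p − k·z, k) + ∑_{i=1}^{m} z_i · C(p − k·z − 1, k − e_i) ) · C(q + k·z, n − k) = C(p + q, n), where C(x, k − e_i) = 0 if k_i = 0. -/

import Mathlib

/-- The multinomial coefficient `C(x, k) = x(x-1)⋯(x-|k|+1)/k!` for `x : ℝ`
and a multi-index `k : Fin m → ℕ`. -/
noncomputable def mchoose {m : ℕ} (x : ℝ) (k : Fin m → ℕ) : ℝ :=
  (∏ j ∈ Finset.range (∑ i, k i), (x - (j : ℝ))) / ∏ i, (Nat.factorial (k i) : ℝ)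

/-- The multinomial coefficient `C(x, k − eᵢ)`, with the convention that it is `0`
when `kᵢ = 0` (i.e. when `k − eᵢ` has a negative component). -/
noncomputable def mchooseSub {m : ℕ} (x : ℝ) (k : Fin m → ℕ) (i : Fin m) : ℝ :=
  if k i = 0 then 0 else mchoose x (k - Pi.single i 1)

/-- The dot product `k·z = k₁z₁ + ⋯ + kₘzₘ` of multi-indices. -/
def mdot {m : ℕ} (k z : Fin m → ℕ) : ℕ := ∑ i, k i * z i

open Finset

lemma single_le_of_ne_zero {m : ℕ} {k : Fin m → ℕ} {i : Fin m} (h : k i ≠ 0) :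
    Pi.single i 1 ≤ k := by
  intro j
  rcases eq_or_ne j i with rfl | hj
  · simpa using Nat.one_le_iff_ne_zero.mpr h
  · simp [Pi.single_eq_of_ne hj]

/-- The closed form behind `C(x, k - eᵢ) = (kᵢ / (x + 1)) C(x + 1, k)`. -/
lemma mchooseSub_eq {m : ℕ} (x : ℝ) (k : Fin m → ℕ) (i : Fin m) :
    mchooseSub x k i =
      (k i : ℝ) * (∏ j ∈ range ((∑ i, k i) - 1), (x - (j : ℝ))) /
        ∏ i, (Nat.factorial (k i) : ℝ) := by
  unfold mchooseSub
  split_ifs with h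
  · simp [h]
  obtain ⟨l, rfl⟩ : ∃ l : Fin m → ℕ, k = l + Pi.single i 1 :=
    ⟨k - Pi.single i 1, (tsub_add_cancel_of_le (single_le_of_ne_zero h)).symm⟩
  have hsum : ∑ j, (l + Pi.single i 1 : Fin m → ℕ) j = ∑ j, l j + 1 := by
    simp [Finset.sum_add_distrib]
  have hfact : ∏ j, (Nat.factorial ((l + Pi.single i 1 : Fin m → ℕ) j) : ℝ) =
      (l i + 1) * ∏ j, (Nat.factorial (l j) : ℝ) := by
    rw [← Finset.mul_prod_erase univ _ (mem_univ i),
      ← Finset.mul_prod_erase univ (fun j => (Nat.factorial (l j) : ℝ)) (mem_univ i),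
      Finset.prod_congr rfl (g := fun j => (Nat.factorial (l j) : ℝ))]
    · simp [Nat.factorial_succ, mul_assoc]
    · intro j hj
      simp [Pi.single_eq_of_ne (ne_of_mem_erase hj)]
  have h0 : (l i + 1 : ℝ) ≠ 0 := by positivity
  rw [hsum, hfact, add_tsub_cancel_right, mchoose, Nat.add_sub_cancel, Pi.add_apply,
    Pi.single_eq_same, Nat.cast_add, Nat.cast_one, mul_div_mul_left _ _ h0]

lemma mchoose_zero {m : ℕ} (x : ℝ) : mchoose x (0 : Fin m → ℕ) = 1 := by
  simp [mchoose]

lemma exists_sum_eq_succ {m : ℕ} {k : Fin m → ℕ} (hk : k ≠ 0) : ∃ N, ∑ i, k i = N + 1 := by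
  refine Nat.exists_eq_succ_of_ne_zero fun h => hk ?_
  ext i
  exact (Finset.sum_eq_zero_iff.mp h) i (mem_univ i)

/-- Pascal's rule for multinomial coefficients. -/
lemma mchoose_add_one {m : ℕ} (x : ℝ) (k : Fin m → ℕ) :
    mchoose (x + 1) k = mchoose x k + ∑ i, mchooseSub x k i := by
  by_cases hk : k = 0
  · subst hk
    simp [mchoose_zero, mchooseSub]
  obtain ⟨N, hN⟩ := exists_sum_eq_succ hk
  have hcast : ∑ i, (k i : ℝ) = N + 1 := by exact_mod_cast hN
  simp only [mchooseSub_eq, ← Finset.sum_div, ← Finset.sum_mul, mchoose, hN, hcast,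
    Nat.add_sub_cancel, ← add_div]
  congr 1
  rw [Finset.prod_range_succ', Finset.prod_range_succ]
  have : ∀ j : ℕ, x + 1 - ((j + 1 : ℕ) : ℝ) = x - j := fun j => by push_cast; ring
  simp only [this]
  push_cast
  ring

/-- The first factor of the summand, `C(p - k·z, k) + ∑ᵢ zᵢ C(p - k·z - 1, k - eᵢ)`. -/
noncomputable def gouldCoeff {m : ℕ} (z : Fin m → ℕ) (p : ℝ) (k : Fin m → ℕ) : ℝ :=
  mchoose (p - (mdot k z : ℕ)) k +
    ∑ i, (z i : ℝ) * mchooseSub (p - (mdot k z : ℕ) - 1) k i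

lemma gouldCoeff_zero_right {m : ℕ} (z : Fin m → ℕ) (p : ℝ) : gouldCoeff z p 0 = 1 := by
  simp [gouldCoeff, mchoose_zero, mchooseSub]

lemma gouldCoeff_zero_of_ne {m : ℕ} (z : Fin m → ℕ) {k : Fin m → ℕ} (hk : k ≠ 0) :
    gouldCoeff z 0 k = 0 := by
  obtain ⟨N, hN⟩ := exists_sum_eq_succ hk
  have hz : ((mdot k z : ℕ) : ℝ) = ∑ i, (z i : ℝ) * k i := by
    simp [mdot, mul_comm]
  have hshift : ∀ x : ℝ, ∀ j : ℕ, x - ((j + 1 : ℕ) : ℝ) = x - 1 - j :=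
    fun x j => by push_cast; ring
  simp only [gouldCoeff, mchooseSub_eq, mchoose, hN, Nat.add_sub_cancel,
    Finset.prod_range_succ', hshift, mul_div_assoc, ← mul_assoc, ← Finset.sum_mul, ← hz]
  push_cast
  ring

lemma mdot_sub_single {m : ℕ} {k : Fin m → ℕ} (z : Fin m → ℕ) {i : Fin m} (h : k i ≠ 0) :
    mdot k z = mdot (k - Pi.single i 1) z + z i := by
  obtain ⟨l, rfl⟩ := exists_add_of_le (single_le_of_ne_zero h)
  simp [mdot, add_mul, Finset.sum_add_distrib, Pi.single_apply, add_comm]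

lemma mchooseSub_sub_single_comm {m : ℕ} (x : ℝ) (k : Fin m → ℕ) (i j : Fin m) :
    (if k i = 0 then 0 else mchooseSub x (k - Pi.single i 1) j) =
      if k j = 0 then 0 else mchooseSub x (k - Pi.single j 1) i := by
  rcases eq_or_ne i j with rfl | hij
  · rfl
  · simp only [mchooseSub, Pi.sub_apply, Pi.single_eq_of_ne hij, Pi.single_eq_of_ne hij.symm,
      tsub_zero, tsub_right_comm (a := k) (b := Pi.single i 1)]
    split_ifs <;> rfl

lemma gouldCoeff_add_one {m : ℕ} (z : Fin m → ℕ) (p : ℝ) (k : Fin m → ℕ) :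
    gouldCoeff z (p + 1) k = gouldCoeff z p k +
      ∑ i, if k i = 0 then 0 else gouldCoeff z (p - z i) (k - Pi.single i 1) := by
  set x : ℝ := p - (mdot k z : ℕ) with hx
  have hsub : ∀ i, mchooseSub x k i = mchooseSub (x - 1) k i +
      ∑ j, if k i = 0 then 0 else mchooseSub (x - 1) (k - Pi.single i 1) j := by
    intro i
    by_cases h : k i = 0
    · simp [mchooseSub, h]
    · have := mchoose_add_one (x - 1) (k - Pi.single i 1)
      rw [sub_add_cancel] at this
      rw [mchooseSub, mchooseSub, if_neg h, if_neg h, this]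
      simp [h]
  have hshift : ∀ i, (if k i = 0 then 0 else gouldCoeff z (p - z i) (k - Pi.single i 1)) =
      mchooseSub x k i + ∑ j, (z j : ℝ) *
        if k i = 0 then 0 else mchooseSub (x - 1) (k - Pi.single i 1) j := by
    intro i
    by_cases h : k i = 0
    · simp [mchooseSub, h]
    · have : p - (z i : ℝ) - (mdot (k - Pi.single i 1) z : ℕ) = x := by
        rw [hx, mdot_sub_single z h]
        push_cast
        ring
      have hk : mchooseSub x k i = mchoose x (k - Pi.single i 1) := if_neg h
      simp only [if_neg h, gouldCoeff, this, hk]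
  have hx1 : p + 1 - ((mdot k z : ℕ) : ℝ) = x + 1 := by rw [hx]; ring
  have hcomm : ∑ i, ∑ j, (z j : ℝ) *
        (if k i = 0 then 0 else mchooseSub (x - 1) (k - Pi.single i 1) j) =
      ∑ i, (z i : ℝ) * ∑ j, if k i = 0 then 0 else
        mchooseSub (x - 1) (k - Pi.single i 1) j := by
    rw [Finset.sum_comm]
    simp only [Finset.mul_sum]
    refine Finset.sum_congr rfl fun i _ => Finset.sum_congr rfl fun j _ => ?_
    rw [mchooseSub_sub_single_comm]
  have hz : ∑ i, (z i : ℝ) * mchooseSub x k i =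
      ∑ i, (z i : ℝ) * mchooseSub (x - 1) k i +
        ∑ i, (z i : ℝ) * ∑ j, if k i = 0 then 0 else
          mchooseSub (x - 1) (k - Pi.single i 1) j := by
    rw [← Finset.sum_add_distrib]
    exact Finset.sum_congr rfl fun i _ => by rw [hsub, mul_add]
  simp only [hshift]
  rw [Finset.sum_add_distrib, hcomm]
  simp only [gouldCoeff, hx1, add_sub_cancel_right, ← hx]
  rw [mchoose_add_one, hz]
  ring

lemma sum_Iic_sub_single {m : ℕ} (n : Fin m → ℕ) (i : Fin m)
    (f : (Fin m → ℕ) → ℝ) :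
    ∑ k ∈ Iic n, (if k i = 0 then 0 else f (k - Pi.single i 1)) =
      if n i = 0 then 0 else ∑ k ∈ Iic (n - Pi.single i 1), f k := by
  split_ifs with hn
  · refine Finset.sum_eq_zero fun k hk => if_pos ?_
    exact Nat.eq_zero_of_le_zero (hn ▸ mem_Iic.mp hk i)
  · have hle := single_le_of_ne_zero hn
    simp only [← ite_not (_ = 0)]
    rw [← Finset.sum_filter]
    refine Finset.sum_nbij' (fun k => k - Pi.single i 1) (fun k => k + Pi.single i 1) ?_ ?_ ?_ ?_ ?_
    · intro k hk
      exact mem_Iic.mpr (tsub_le_tsub_right (mem_Iic.mp (mem_filter.mp hk).1) _)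
    · intro k hk
      simpa using (le_tsub_iff_right hle).mp (mem_Iic.mp hk)
    · intro k hk
      exact tsub_add_cancel_of_le (single_le_of_ne_zero (mem_filter.mp hk).2)
    · intro k _
      exact add_tsub_cancel_right _ _
    · intros
      rfl

/-- Both sides obey the same first-order recurrence in `p`, and agree at `p = 0`. -/
lemma sum_gouldCoeff_mul_mchoose {m : ℕ} (z n : Fin m → ℕ) (p : ℤ) (q : ℝ) :
    ∑ k ∈ Iic n, gouldCoeff z p k * mchoose (q + (mdot k z : ℕ)) (n - k) =
      mchoose (p + q) n := by
  induction hN : ∑ i, n i using Nat.strong_induction_on generalizing n p q with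
  | _ N ih =>
  have hstep : ∀ p : ℤ,
      ∑ k ∈ Iic n, gouldCoeff z (p + 1) k * mchoose (q + (mdot k z : ℕ)) (n - k) =
        ∑ k ∈ Iic n, gouldCoeff z p k * mchoose (q + (mdot k z : ℕ)) (n - k) +
          ∑ i, mchooseSub (p + q) n i := by
    intro p
    simp only [gouldCoeff_add_one, add_mul, Finset.sum_add_distrib, Finset.sum_mul]
    congr 1
    rw [Finset.sum_comm]
    refine Finset.sum_congr rfl fun i _ => ?_
    refine Eq.trans (Finset.sum_congr rfl fun k _ => ?_)
      ((sum_Iic_sub_single n i fun l => gouldCoeff z ((p - z i : ℤ) : ℝ) l *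
        mchoose (q + z i + (mdot l z : ℕ)) (n - Pi.single i 1 - l)).trans ?_)
    · by_cases h : k i = 0
      · simp [h]
      · have hq : q + ((mdot k z : ℕ) : ℝ) = q + z i + (mdot (k - Pi.single i 1) z : ℕ) := by
          rw [mdot_sub_single z h]
          push_cast
          ring
        have hk : n - k = n - Pi.single i 1 - (k - Pi.single i 1) := by
          rw [tsub_tsub, add_tsub_cancel_of_le (single_le_of_ne_zero h)]
        simp only [if_neg h, hq]
        rw [hk]
        push_cast
        rfl
    · rw [mchooseSub]
      by_cases h : n i = 0
      · simp [h]
      · rw [if_neg h, if_neg h, ih _ _ _ _ _ rfl]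
        · congr 1
          push_cast
          ring
        · rw [← hN]
          refine Finset.sum_lt_sum (fun j _ => Nat.sub_le _ _) ⟨i, mem_univ i, ?_⟩
          simp only [Pi.sub_apply, Pi.single_eq_same]
          omega
  have hpascal : ∀ p : ℤ, mchoose ((p : ℝ) + 1 + q) n =
      mchoose (p + q) n + ∑ i, mchooseSub (p + q) n i := by
    intro p
    rw [← mchoose_add_one, add_right_comm]
  induction p using Int.induction_on with
  | zero =>
    rw [Finset.sum_eq_single_of_mem 0 (mem_Iic.mpr zero_le)]
    · simp [gouldCoeff_zero_right, mdot]
    · intro k _ hk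
      rw [Int.cast_zero, gouldCoeff_zero_of_ne z hk, zero_mul]
  | succ p hp =>
    rw [Int.cast_add, Int.cast_one, hstep, hpascal, hp]
  | pred p hp =>
    have h1 := hstep (-p - 1)
    have h2 := hpascal (-p - 1)
    have hc : (((-p - 1 : ℤ) : ℝ) + 1) = ((-p : ℤ) : ℝ) := by push_cast; ring
    rw [hc] at h1 h2
    linarith

/-- **Equation (3.3)**: for `p ≥ n·z` and `q ≥ 1`,
`∑_{k=0}^{n} ( C(p − k·z, k) + ∑_{i=1}^{m} zᵢ · C(p − k·z − 1, k − eᵢ) ) · C(q + k·z, n − k)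
  = C(p + q, n)`. -/
theorem simplified_key_identity (m : ℕ) (hm : 0 < m) (n z : Fin m → ℕ)
    (p q : ℕ) (hp : mdot n z ≤ p) (hq : 1 ≤ q) :
    ∑ k ∈ Finset.Iic n,
        (mchoose ((p : ℝ) - (mdot k z : ℕ)) k +
            ∑ i, (z i : ℝ) * mchooseSub ((p : ℝ) - (mdot k z : ℕ) - 1) k i) *
          mchoose ((q : ℝ) + (mdot k z : ℕ)) (n - k) =
      mchoose ((p : ℝ) + (q : ℝ)) n := by
  simpa only [gouldCoeff, Int.cast_natCast] using sum_gouldCoeff_mul_mchoose z n p q
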